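/- For any integers c, n with 3 ≤ c ≤ n: A(3,c,n) = 3/4 if c = 3, and A(3,c,n) = 1 if c > 3. -/

import Mathlib

open SimpleGraph Set

/-- Auxiliary distance on representations of points of the metric graph:
a point is represented by `(u, v, t)` with `u, v` adjacent and `t ∈ [0,1]`,
meaning the point on the edge `[u,v]` at distance `t` from `u`. -/
noncomputable def mgDistAux {V : Type} [Fintype V] [DecidableEq V] (G : SimpleGraph V)
    (p q : V × V × ℝ) : ℝ :=
  min
    (min (if p.1 = q.1 ∧ p.2.1 = q.2.1 then |p.2.2 - q.2.2| else (Fintype.card V : ℝ) + 1)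
         (if p.1 = q.2.1 ∧ p.2.1 = q.1 then |p.2.2 - (1 - q.2.2)| else (Fintype.card V : ℝ) + 1))
    (min (min (p.2.2 + (G.dist p.1 q.1 : ℝ) + q.2.2)
              (p.2.2 + (G.dist p.1 q.2.1 : ℝ) + (1 - q.2.2)))
         (min ((1 - p.2.2) + (G.dist p.2.1 q.1 : ℝ) + q.2.2)
              ((1 - p.2.2) + (G.dist p.2.1 q.2.1 : ℝ) + (1 - q.2.2))))

/-- The points of the metric graph associated to a simple graph `G`:
the vertices together with the interior points of the edges. -/
def MGPoint {V : Type} (G : SimpleGraph V) : Type :=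
  {p : V × V × ℝ // G.Adj p.1 p.2.1 ∧ p.2.2 ∈ Set.Icc (0 : ℝ) 1}

/-- The shortest-path distance on the metric graph associated to `G`
(every edge has length 1). -/
noncomputable def mgDist {V : Type} [Fintype V] [DecidableEq V] (G : SimpleGraph V)
    (p q : MGPoint G) : ℝ := mgDistAux G p.1 q.1

/-- Distance from a vertex `v` to a point of the metric graph. -/
noncomputable def mgVDist {V : Type} [Fintype V] [DecidableEq V] (G : SimpleGraph V)
    (v : V) (x : MGPoint G) : ℝ :=
  min ((G.dist v x.1.1 : ℝ) + x.1.2.2) ((G.dist v x.1.2.1 : ℝ) + (1 - x.1.2.2))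

/-- `γ` restricted to `[a,b]` is a geodesic in the metric graph of `G`
(an arc-length parametrization realizing distances). -/
def IsMGGeodesic {V : Type} [Fintype V] [DecidableEq V] (G : SimpleGraph V)
    (a b : ℝ) (γ : ℝ → MGPoint G) : Prop :=
  a ≤ b ∧ ∀ s ∈ Set.Icc a b, ∀ t ∈ Set.Icc a b, mgDist G (γ s) (γ t) = |s - t|

/-- A geodesic triangle in the metric graph of `G`: three geodesic sides whose
endpoints match cyclically (distance `0` means equality of points). -/
structure MGTriangle {V : Type} [Fintype V] [DecidableEq V] (G : SimpleGraph V) where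
  a1 : ℝ
  b1 : ℝ
  a2 : ℝ
  b2 : ℝ
  a3 : ℝ
  b3 : ℝ
  g1 : ℝ → MGPoint G
  g2 : ℝ → MGPoint G
  g3 : ℝ → MGPoint G
  h1 : IsMGGeodesic G a1 b1 g1
  h2 : IsMGGeodesic G a2 b2 g2
  h3 : IsMGGeodesic G a3 b3 g3
  glue1 : mgDist G (g1 b1) (g2 a2) = 0
  glue2 : mgDist G (g2 b2) (g3 a3) = 0
  glue3 : mgDist G (g3 b3) (g1 a1) = 0

/-- The sharp thin constant `δ(T)` of a geodesic triangle: the infimum of the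
`d ≥ 0` such that each side is contained in the `d`-neighborhood of the union of
the other two sides. -/
noncomputable def triangleDelta {V : Type} [Fintype V] [DecidableEq V] {G : SimpleGraph V}
    (T : MGTriangle G) : ℝ :=
  sInf {d : ℝ | 0 ≤ d ∧
    (∀ s ∈ Set.Icc T.a1 T.b1,
      (∃ t ∈ Set.Icc T.a2 T.b2, mgDist G (T.g1 s) (T.g2 t) ≤ d) ∨
      (∃ t ∈ Set.Icc T.a3 T.b3, mgDist G (T.g1 s) (T.g3 t) ≤ d)) ∧
    (∀ s ∈ Set.Icc T.a2 T.b2,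
      (∃ t ∈ Set.Icc T.a1 T.b1, mgDist G (T.g2 s) (T.g1 t) ≤ d) ∨
      (∃ t ∈ Set.Icc T.a3 T.b3, mgDist G (T.g2 s) (T.g3 t) ≤ d)) ∧
    (∀ s ∈ Set.Icc T.a3 T.b3,
      (∃ t ∈ Set.Icc T.a1 T.b1, mgDist G (T.g3 s) (T.g1 t) ≤ d) ∨
      (∃ t ∈ Set.Icc T.a2 T.b2, mgDist G (T.g3 s) (T.g2 t) ≤ d))}

/-- The hyperbolicity constant `δ(G)`: the supremum of `δ(T)` over all geodesic
triangles `T` in the metric graph of `G`. -/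
noncomputable def hypDelta {V : Type} [Fintype V] [DecidableEq V] (G : SimpleGraph V) : ℝ :=
  sSup {d : ℝ | ∃ T : MGTriangle G, d = triangleDelta T}

/-- The circumference of `G`: the length of a longest cycle. -/
noncomputable def circumference {V : Type} (G : SimpleGraph V) : ℕ :=
  sSup {n : ℕ | ∃ (a : V) (w : G.Walk a a), w.IsCycle ∧ w.length = n}

/-- `G` belongs to the class `𝒢(g,c,n)` of (connected) graphs with girth `g`,
circumference `c` and `n` vertices (vertex set `Fin n`). -/
def memGclass (g c : ℕ) {n : ℕ} (G : SimpleGraph (Fin n)) : Prop :=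
  G.Connected ∧ G.girth = g ∧ circumference G = c

/-- `A(g,c,n) = min {δ(G) : G ∈ 𝒢(g,c,n)}`. -/
noncomputable def Agcn (g c n : ℕ) : ℝ :=
  sInf {d : ℝ | ∃ G : SimpleGraph (Fin n), memGclass g c G ∧ d = hypDelta G}

/-- `B(g,c,n) = max {δ(G) : G ∈ 𝒢(g,c,n)}`. -/
noncomputable def Bgcn (g c n : ℕ) : ℝ :=
  sSup {d : ℝ | ∃ G : SimpleGraph (Fin n), memGclass g c G ∧ d = hypDelta G}

/-- `G` belongs to the class `ℋ(g,c,m)` of (connected) graphs with girth `g`,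
circumference `c` and `m` edges. -/
def memHclass (g c m : ℕ) {k : ℕ} (G : SimpleGraph (Fin k)) : Prop :=
  G.Connected ∧ G.girth = g ∧ circumference G = c ∧ G.edgeSet.ncard = m

/-- `α(g,c,m) = min {δ(G) : G ∈ ℋ(g,c,m)}`. -/
noncomputable def alphagcm (g c m : ℕ) : ℝ :=
  sInf {d : ℝ | ∃ (k : ℕ) (G : SimpleGraph (Fin k)), memHclass g c m G ∧ d = hypDelta G}

/-- `β(g,c,m) = max {δ(G) : G ∈ ℋ(g,c,m)}`. -/
noncomputable def betagcm (g c m : ℕ) : ℝ :=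
  sSup {d : ℝ | ∃ (k : ℕ) (G : SimpleGraph (Fin k)), memHclass g c m G ∧ d = hypDelta G}


set_option linter.unusedSectionVars false
set_option linter.unusedSimpArgs false

section MetricBasics

variable {V : Type} [Fintype V] [DecidableEq V] {G : SimpleGraph V}

lemma dist_le_cardR (hG : G.Connected) (u v : V) :
    (G.dist u v : ℝ) + 1 ≤ Fintype.card V := by
  obtain ⟨p, hp, hl⟩ := hG.exists_path_of_dist u v
  have := hp.length_lt
  rw [hl] at this
  exact_mod_cast this

lemma dist_triR (hG : G.Connected) (u v w : V) :
    (G.dist u w : ℝ) ≤ G.dist u v + G.dist v w := by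
  exact_mod_cast hG.dist_triangle

lemma le_mgDist (hG : G.Connected) (p q : MGPoint G) (m : ℝ)
    (h1 : p.1.1 = q.1.1 → p.1.2.1 = q.1.2.1 → m ≤ |p.1.2.2 - q.1.2.2|)
    (h2 : p.1.1 = q.1.2.1 → p.1.2.1 = q.1.1 → m ≤ |p.1.2.2 - (1 - q.1.2.2)|)
    (h3 : m ≤ p.1.2.2 + (G.dist p.1.1 q.1.1 : ℝ) + q.1.2.2)
    (h4 : m ≤ p.1.2.2 + (G.dist p.1.1 q.1.2.1 : ℝ) + (1 - q.1.2.2))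
    (h5 : m ≤ (1 - p.1.2.2) + (G.dist p.1.2.1 q.1.1 : ℝ) + q.1.2.2)
    (h6 : m ≤ (1 - p.1.2.2) + (G.dist p.1.2.1 q.1.2.1 : ℝ) + (1 - q.1.2.2)) :
    m ≤ mgDist G p q := by
  have hm : m ≤ (Fintype.card V : ℝ) + 1 := by
    have := dist_le_cardR hG p.1.1 q.1.1
    have := dist_le_cardR hG p.1.2.1 q.1.2.1
    linarith
  unfold mgDist mgDistAux
  refine le_min (le_min ?_ ?_) (le_min (le_min h3 h4) (le_min h5 h6))
  · split_ifs with h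
    · exact h1 h.1 h.2
    · exact hm
  · split_ifs with h
    · exact h2 h.1 h.2
    · exact hm

lemma mgDist_le1 (p q : MGPoint G) (h : p.1.1 = q.1.1) (h' : p.1.2.1 = q.1.2.1) :
    mgDist G p q ≤ |p.1.2.2 - q.1.2.2| := by
  unfold mgDist mgDistAux
  rw [if_pos ⟨h, h'⟩]
  exact (min_le_left _ _).trans (min_le_left _ _)

lemma mgDist_le2 (p q : MGPoint G) (h : p.1.1 = q.1.2.1) (h' : p.1.2.1 = q.1.1) :
    mgDist G p q ≤ |p.1.2.2 - (1 - q.1.2.2)| := by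
  unfold mgDist mgDistAux
  rw [if_pos (c := p.1.1 = q.1.2.1 ∧ p.1.2.1 = q.1.1) ⟨h, h'⟩]
  exact (min_le_left _ _).trans (min_le_right _ _)

lemma mgDist_le3 (p q : MGPoint G) :
    mgDist G p q ≤ p.1.2.2 + (G.dist p.1.1 q.1.1 : ℝ) + q.1.2.2 :=
  (min_le_right _ _).trans ((min_le_left _ _).trans (min_le_left _ _))

lemma mgDist_le4 (p q : MGPoint G) :
    mgDist G p q ≤ p.1.2.2 + (G.dist p.1.1 q.1.2.1 : ℝ) + (1 - q.1.2.2) :=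
  (min_le_right _ _).trans ((min_le_left _ _).trans (min_le_right _ _))

lemma mgDist_le5 (p q : MGPoint G) :
    mgDist G p q ≤ (1 - p.1.2.2) + (G.dist p.1.2.1 q.1.1 : ℝ) + q.1.2.2 :=
  (min_le_right _ _).trans ((min_le_right _ _).trans (min_le_left _ _))

lemma mgDist_le6 (p q : MGPoint G) :
    mgDist G p q ≤ (1 - p.1.2.2) + (G.dist p.1.2.1 q.1.2.1 : ℝ) + (1 - q.1.2.2) :=
  (min_le_right _ _).trans ((min_le_right _ _).trans (min_le_right _ _))

lemma mgDist_nonneg (hG : G.Connected) (p q : MGPoint G) : 0 ≤ mgDist G p q := by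
  have ht0 := p.2.2.1
  have ht1 := p.2.2.2
  have hs0 := q.2.2.1
  have hs1 := q.2.2.2
  apply le_mgDist hG
  · intros; positivity
  · intros; positivity
  all_goals
    have : ∀ u v, (0:ℝ) ≤ G.dist u v := fun u v => by positivity
    linarith [this p.1.1 q.1.1, this p.1.1 q.1.2.1, this p.1.2.1 q.1.1, this p.1.2.1 q.1.2.1]

lemma mgDist_self (hG : G.Connected) (p : MGPoint G) : mgDist G p p = 0 := by
  apply le_antisymm
  · simpa using mgDist_le1 p p rfl rfl
  · exact mgDist_nonneg hG p p

lemma mgDist_comm_le (hG : G.Connected) (p q : MGPoint G) : mgDist G p q ≤ mgDist G q p := by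
  apply le_mgDist hG
  · intro h h'
    rw [abs_sub_comm]; exact mgDist_le1 p q h.symm h'.symm
  · intro h h'
    refine (mgDist_le2 p q h'.symm h.symm).trans (le_of_eq ?_)
    congr 1; ring
  · have := mgDist_le3 p q
    rw [SimpleGraph.dist_comm] at this; linarith
  · have := mgDist_le5 p q
    rw [SimpleGraph.dist_comm] at this; linarith
  · have := mgDist_le4 p q
    rw [SimpleGraph.dist_comm] at this; linarith
  · have := mgDist_le6 p q
    rw [SimpleGraph.dist_comm] at this; linarith

lemma mgDist_comm (hG : G.Connected) (p q : MGPoint G) : mgDist G p q = mgDist G q p :=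
  le_antisymm (mgDist_comm_le hG p q) (mgDist_comm_le hG q p)

lemma mgDist_triangle (hG : G.Connected) (p q r : MGPoint G) :
    mgDist G p r ≤ mgDist G p q + mgDist G q r := by
  rw [← sub_le_iff_le_add]
  obtain ⟨⟨p1, p2, t⟩, hp, ht⟩ := p
  obtain ⟨⟨q1, q2, s⟩, hq, hs⟩ := q
  obtain ⟨⟨r1, r2, x⟩, hr, hx⟩ := r
  have hq' : (G.dist q1 q2 : ℝ) = 1 := by exact_mod_cast SimpleGraph.dist_eq_one_iff_adj.mpr hq
  have hq'' : (G.dist q2 q1 : ℝ) = 1 := by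
    exact_mod_cast SimpleGraph.dist_eq_one_iff_adj.mpr hq.symm
  have ht0 : 0 ≤ t := ht.1
  have ht1 : t ≤ 1 := ht.2
  have hs0 : 0 ≤ s := hs.1
  have hs1 : s ≤ 1 := hs.2
  have hx0 : 0 ≤ x := hx.1
  have hx1 : x ≤ 1 := hx.2
  have nn : ∀ u v, (0:ℝ) ≤ G.dist u v := fun u v => by positivity
  have tri := dist_triR hG
  have e1 := mgDist_le1 (G := G) ⟨⟨p1, p2, t⟩, hp, ht⟩ ⟨⟨r1, r2, x⟩, hr, hx⟩
  have e2 := mgDist_le2 (G := G) ⟨⟨p1, p2, t⟩, hp, ht⟩ ⟨⟨r1, r2, x⟩, hr, hx⟩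
  have e3 := mgDist_le3 (G := G) ⟨⟨p1, p2, t⟩, hp, ht⟩ ⟨⟨r1, r2, x⟩, hr, hx⟩
  have e4 := mgDist_le4 (G := G) ⟨⟨p1, p2, t⟩, hp, ht⟩ ⟨⟨r1, r2, x⟩, hr, hx⟩
  have e5 := mgDist_le5 (G := G) ⟨⟨p1, p2, t⟩, hp, ht⟩ ⟨⟨r1, r2, x⟩, hr, hx⟩
  have e6 := mgDist_le6 (G := G) ⟨⟨p1, p2, t⟩, hp, ht⟩ ⟨⟨r1, r2, x⟩, hr, hx⟩
  dsimp only at e1 e2 e3 e4 e5 e6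
  apply le_mgDist hG <;> dsimp only
  · rintro rfl rfl
    rw [sub_le_comm]
    have k1 := le_abs_self (t - s)
    have k2 := neg_abs_le (t - s)
    apply le_mgDist hG <;> dsimp only
    · intro h h'
      have := e1 h h'
      have := abs_sub_le t s x
      linarith
    · intro h h'
      have := e2 h h'
      have := abs_sub_le t s (1 - x)
      linarith
    all_goals linarith
  · rintro rfl rfl
    rw [sub_le_comm]
    have k1 := le_abs_self (t - (1 - s))
    have k2 := neg_abs_le (t - (1 - s))
    apply le_mgDist hG <;> dsimp only
    · intro h h'
      have := e2 h' h
      have := abs_sub_le t (1 - s) (1 - x)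
      have : |(1 - s) - (1 - x)| = |s - x| := by rw [abs_sub_comm]; congr 1; ring
      linarith
    · intro h h'
      have := e1 h' h
      have := abs_sub_le t (1 - s) x
      have : |(1 - s) - x| = |s - (1 - x)| := by rw [abs_sub_comm]; congr 1; ring
      linarith
    all_goals linarith
  all_goals
    rw [sub_le_comm]
    apply le_mgDist hG <;> dsimp only
    · rintro rfl rfl
      have k1 := le_abs_self (s - x)
      have k2 := neg_abs_le (s - x)
      linarith
    · rintro rfl rfl
      have k1 := le_abs_self (s - (1 - x))
      have k2 := neg_abs_le (s - (1 - x))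
      linarith
    all_goals
     linarith [tri p1 q1 r1, tri p1 q1 r2, tri p1 q2 r1, tri p1 q2 r2,
      tri p2 q1 r1, tri p2 q1 r2, tri p2 q2 r1, tri p2 q2 r2,
      tri p1 q1 q2, tri p1 q2 q1, tri p2 q1 q2, tri p2 q2 q1,
      tri q1 q2 r1, tri q1 q2 r2, tri q2 q1 r1, tri q2 q1 r2]

end MetricBasics

section Thin

variable {V : Type} [Fintype V] [DecidableEq V] {G : SimpleGraph V}

/-- Data of a cut point decomposition: points with different labels are separated by `O`. -/
def CutData (G : SimpleGraph V) (O : MGPoint G) (lab : MGPoint G → ℕ) (D : ℝ) : Prop :=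
  (∀ p, mgDist G p O ≤ 3 / 2) ∧ 3 / 2 ≤ D ∧
  (∀ p q, lab p = lab q → mgDist G p q ≤ D) ∧
  (∀ p q, lab p ≠ lab q → mgDist G p O + mgDist G q O ≤ mgDist G p q)

lemma CutData.pass (hG : G.Connected) {O : MGPoint G} {lab : MGPoint G → ℕ} {D : ℝ}
    (h : CutData G O lab D) {a b : ℝ} {γ : ℝ → MGPoint G} (hγ : IsMGGeodesic G a b γ)
    (hl : lab (γ a) ≠ lab (γ b)) :
    ∃ t ∈ Set.Icc a b, mgDist G (γ t) O = 0 ∧ t - a ≤ 3 / 2 ∧ b - t ≤ 3 / 2 := by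
  obtain ⟨hab, hd⟩ := hγ
  obtain ⟨hO, -, -, hs⟩ := h
  have ha : a ∈ Set.Icc a b := ⟨le_rfl, hab⟩
  have hb : b ∈ Set.Icc a b := ⟨hab, le_rfl⟩
  have h1 := hs _ _ hl
  have h2 := hd a ha b hb
  rw [abs_sub_comm, abs_of_nonneg (by linarith)] at h2
  have n1 := mgDist_nonneg hG (γ a) O
  have n2 := mgDist_nonneg hG (γ b) O
  have h4 := mgDist_triangle hG (γ a) O (γ b)
  rw [mgDist_comm hG O] at h4
  set t := a + mgDist G (γ a) O with ht
  have htm : t ∈ Set.Icc a b := ⟨by linarith, by linarith⟩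
  refine ⟨t, htm, ?_, ?_, ?_⟩
  · have h5 := hd a ha t htm
    have h6 := hd t htm b hb
    rw [abs_sub_comm, abs_of_nonneg (by linarith)] at h5
    rw [abs_sub_comm, abs_of_nonneg (by linarith [htm.2])] at h6
    have n3 := mgDist_nonneg hG (γ t) O
    by_cases hc : lab (γ a) = lab (γ t)
    · have := hs (γ t) (γ b) (by rwa [← hc])
      linarith
    · have := hs _ _ hc
      linarith
  · linarith [hO (γ a)]
  · linarith [hO (γ b)]

lemma CutData.side (hG : G.Connected) {O : MGPoint G} {lab : MGPoint G → ℕ} {D : ℝ}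
    (h : CutData G O lab D) {a1 b1 a2 b2 a3 b3 : ℝ} {g1 g2 g3 : ℝ → MGPoint G}
    (h1 : IsMGGeodesic G a1 b1 g1) (h2 : IsMGGeodesic G a2 b2 g2) (h3 : IsMGGeodesic G a3 b3 g3)
    (e1 : mgDist G (g1 b1) (g2 a2) = 0) (e2 : mgDist G (g2 b2) (g3 a3) = 0)
    (e3 : mgDist G (g3 b3) (g1 a1) = 0) :
    ∀ s ∈ Set.Icc a1 b1,
      (∃ t ∈ Set.Icc a2 b2, mgDist G (g1 s) (g2 t) ≤ D / 2) ∨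
      (∃ t ∈ Set.Icc a3 b3, mgDist G (g1 s) (g3 t) ≤ D / 2) := by
  intro s hs
  have ma1 : a1 ∈ Set.Icc a1 b1 := ⟨le_rfl, h1.1⟩
  have mb1 : b1 ∈ Set.Icc a1 b1 := ⟨h1.1, le_rfl⟩
  have ma2 : a2 ∈ Set.Icc a2 b2 := ⟨le_rfl, h2.1⟩
  have mb2 : b2 ∈ Set.Icc a2 b2 := ⟨h2.1, le_rfl⟩
  have ma3 : a3 ∈ Set.Icc a3 b3 := ⟨le_rfl, h3.1⟩
  have mb3 : b3 ∈ Set.Icc a3 b3 := ⟨h3.1, le_rfl⟩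
  have ds : ∀ u ∈ Set.Icc a1 b1, ∀ q, mgDist G (g1 u) q = 0 → |s - u| ≤ D / 2 →
      mgDist G (g1 s) q ≤ D / 2 := by
    intro u hu q hq hsu
    have := mgDist_triangle hG (g1 s) (g1 u) q
    rw [h1.2 s hs u hu] at this
    linarith
  rw [mgDist_comm hG] at e3
  by_cases hA : s - a1 ≤ D / 2
  · exact Or.inr ⟨b3, mb3, ds a1 ma1 _ e3 (by rwa [abs_of_nonneg (by linarith [hs.1])])⟩
  by_cases hB : b1 - s ≤ D / 2
  · exact Or.inl ⟨a2, ma2, ds b1 mb1 _ e1 (by rwa [abs_sub_comm, abs_of_nonneg (by linarith [hs.2])])⟩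
  push Not at hA hB
  have hl : lab (g1 a1) ≠ lab (g1 b1) := by
    intro hl
    have := h.2.2.1 _ _ hl
    rw [h1.2 a1 ma1 b1 mb1, abs_sub_comm, abs_of_nonneg (by linarith [h1.1])] at this
    linarith
  obtain ⟨u, hu, hu0, hua, hub⟩ := h.pass hG h1 hl
  have hD := h.2.1
  have hsu : |s - u| ≤ D / 2 := by
    rw [abs_le]; constructor <;> linarith
  have fin : ∀ q, mgDist G q O = 0 → mgDist G (g1 s) q ≤ D / 2 := by
    intro q hq
    refine ds u hu q ?_ hsu
    have := mgDist_triangle hG (g1 u) O q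
    rw [mgDist_comm hG O] at this
    have := mgDist_nonneg hG (g1 u) q
    linarith
  have glue : ∀ p q, mgDist G p q = 0 → lab p ≠ lab q → mgDist G q O = 0 ∧ mgDist G p O = 0 := by
    intro p q hpq hne
    have := h.2.2.2 p q hne
    have := mgDist_nonneg hG p O
    have := mgDist_nonneg hG q O
    constructor <;> linarith
  by_cases c1 : lab (g1 b1) = lab (g2 a2)
  swap
  · exact Or.inl ⟨a2, ma2, fin _ (glue _ _ e1 c1).1⟩
  by_cases c2 : lab (g2 a2) = lab (g2 b2)
  swap
  · obtain ⟨t, ht, ht0, -⟩ := h.pass hG h2 c2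
    exact Or.inl ⟨t, ht, fin _ ht0⟩
  by_cases c3 : lab (g2 b2) = lab (g3 a3)
  swap
  · exact Or.inr ⟨a3, ma3, fin _ (glue _ _ e2 c3).1⟩
  by_cases c4 : lab (g3 a3) = lab (g3 b3)
  swap
  · obtain ⟨t, ht, ht0, -⟩ := h.pass hG h3 c4
    exact Or.inr ⟨t, ht, fin _ ht0⟩
  have c5 : lab (g1 a1) ≠ lab (g3 b3) := by
    rw [← c4, ← c3, ← c2, ← c1]; exact hl
  exact Or.inr ⟨b3, mb3, fin _ (glue _ _ e3 c5).1⟩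

lemma CutData.hyp_le (hG : G.Connected) {O : MGPoint G} {lab : MGPoint G → ℕ} {D : ℝ}
    (h : CutData G O lab D) : hypDelta G ≤ D / 2 := by
  have hD := h.2.1
  apply Real.sSup_le _ (by linarith)
  rintro d ⟨T, rfl⟩
  apply csInf_le ⟨0, fun x hx => hx.1⟩
  refine ⟨by linarith, ?_, ?_, ?_⟩
  · exact h.side hG T.h1 T.h2 T.h3 T.glue1 T.glue2 T.glue3
  · intro s hs
    exact (h.side hG T.h2 T.h3 T.h1 T.glue2 T.glue3 T.glue1 s hs).symm
  · exact h.side hG T.h3 T.h1 T.h2 T.glue3 T.glue1 T.glue2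

lemma mgDist_le_card (hG : G.Connected) (p q : MGPoint G) :
    mgDist G p q ≤ Fintype.card V := by
  have := mgDist_le3 p q
  have := mgDist_le6 p q
  have := dist_le_cardR hG p.1.1 q.1.1
  have := dist_le_cardR hG p.1.2.1 q.1.2.1
  linarith

lemma hyp_bdd (hG : G.Connected) : BddAbove {d : ℝ | ∃ T : MGTriangle G, d = triangleDelta T} := by
  refine ⟨Fintype.card V, ?_⟩
  rintro d ⟨T, rfl⟩
  apply csInf_le ⟨0, fun x hx => hx.1⟩
  refine ⟨by positivity, ?_, ?_, ?_⟩
  · exact fun s _ => Or.inl ⟨T.a2, ⟨le_rfl, T.h2.1⟩, mgDist_le_card hG _ _⟩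
  · exact fun s _ => Or.inl ⟨T.a1, ⟨le_rfl, T.h1.1⟩, mgDist_le_card hG _ _⟩
  · exact fun s _ => Or.inl ⟨T.a1, ⟨le_rfl, T.h1.1⟩, mgDist_le_card hG _ _⟩

lemma le_hyp_of_bigon (hG : G.Connected) {γ : ℝ → MGPoint G} {a b c s m : ℝ}
    (h1 : IsMGGeodesic G a b γ) (h2 : IsMGGeodesic G b c γ)
    (hg : mgDist G (γ c) (γ a) = 0) (hs : s ∈ Set.Icc a b)
    (hm : ∀ t ∈ Set.Icc b c, m ≤ mgDist G (γ s) (γ t)) : m ≤ hypDelta G := by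
  let T : MGTriangle G :=
    { a1 := a, b1 := b, a2 := b, b2 := c, a3 := c, b3 := c, g1 := γ, g2 := γ, g3 := γ
      h1 := h1, h2 := h2
      h3 := ⟨le_rfl, fun x hx y hy => h2.2 x ⟨h2.1.trans hx.1, hx.2⟩ y ⟨h2.1.trans hy.1, hy.2⟩⟩
      glue1 := mgDist_self hG _
      glue2 := mgDist_self hG _
      glue3 := hg }
  refine le_trans ?_ (le_csSup (hyp_bdd hG) ⟨T, rfl⟩)
  apply le_csInf
  · refine ⟨Fintype.card V, by positivity, ?_, ?_, ?_⟩
    · exact fun s _ => Or.inl ⟨T.a2, ⟨le_rfl, T.h2.1⟩, mgDist_le_card hG _ _⟩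
    · exact fun s _ => Or.inl ⟨T.a1, ⟨le_rfl, T.h1.1⟩, mgDist_le_card hG _ _⟩
    · exact fun s _ => Or.inl ⟨T.a1, ⟨le_rfl, T.h1.1⟩, mgDist_le_card hG _ _⟩
  · rintro d ⟨-, hd, -⟩
    rcases hd s hs with ⟨t, ht, htd⟩ | ⟨t, ht, htd⟩
    · exact (hm t ht).trans htd
    · exact (hm t ⟨h2.1.trans ht.1, ht.2⟩).trans htd

end Thin

section Cycles

variable {V : Type} [Fintype V] [DecidableEq V] {G : SimpleGraph V}

/-- `f : ℤ → V` is an `L`-periodic parametrization of a cycle of length `L`. -/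
def Cyc (G : SimpleGraph V) (L : ℕ) (f : ℤ → V) : Prop :=
  (∀ i, G.Adj (f i) (f (i + 1))) ∧ (∀ i j, f i = f j ↔ (L : ℤ) ∣ i - j)

lemma mkCyc {N : ℕ} (hN : 2 ≤ N) (h : ℕ → V) (hinj : ∀ i j, i < j → j < N → h i ≠ h j)
    (hadj : ∀ i, i + 1 < N → G.Adj (h i) (h (i + 1))) (hcl : G.Adj (h (N - 1)) (h 0)) :
    ∃ f, Cyc G N f := by
  have hN0 : (0 : ℤ) < N := by omega
  refine ⟨fun i => h (i % N).toNat, ?_, ?_⟩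
  · intro i
    have h1 := Int.emod_nonneg i hN0.ne'
    have h2 := Int.emod_lt_of_pos i hN0
    by_cases hc : i % N + 1 < N
    · have : (i + 1) % N = i % N + 1 := by
        rw [Int.add_emod, Int.emod_eq_of_lt (a := 1) (by norm_num) (by omega)]
        exact Int.emod_eq_of_lt (by omega) hc
      simp only [this]
      have e : (i % N + 1).toNat = (i % N).toNat + 1 := by omega
      rw [e]
      exact hadj _ (by omega)
    · have e : i % N = N - 1 := by omega
      have : (i + 1) % N = 0 := by
        rw [Int.add_emod, Int.emod_eq_of_lt (a := 1) (by norm_num) (by omega), e]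
        simp
      simp only [this, e]
      have e : ((N : ℤ) - 1).toNat = N - 1 := by omega
      rw [e]
      exact hcl
  · intro i j
    rw [dvd_sub_comm, ← Int.modEq_iff_dvd]
    have h1 := Int.emod_nonneg i hN0.ne'
    have h2 := Int.emod_lt_of_pos i hN0
    have h3 := Int.emod_nonneg j hN0.ne'
    have h4 := Int.emod_lt_of_pos j hN0
    constructor
    · intro hh
      dsimp only at hh
      rcases lt_trichotomy (i % N) (j % N) with hl | hl | hl
      · exact absurd hh (hinj _ _ (by omega) (by omega))
      · exact hl
      · exact absurd hh.symm (hinj _ _ (by omega) (by omega))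
    · intro hh
      have : i % N = j % N := hh
      simp only [this]

lemma Cyc.of_walk {a : V} {w : G.Walk a a} (hw : w.IsCycle) : ∃ f, Cyc G w.length f := by
  have h3 := hw.three_le_length
  apply mkCyc (by omega) w.getVert
  · intro i j hij hj h
    have := hw.getVert_injOn' (show i ≤ w.length - 1 by omega) (show j ≤ w.length - 1 by omega) h
    omega
  · intro i hi
    exact w.adj_getVert_succ (by omega)
  · have := w.adj_getVert_succ (i := w.length - 1) (by omega)
    rw [show w.length - 1 + 1 = w.length by omega, w.getVert_length] at this
    simpa using this

/-- The arc-length parametrized closed curve of a cycle. -/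
noncomputable def Cyc.curve {L : ℕ} {f : ℤ → V} (h : Cyc G L f) (s : ℝ) : MGPoint G :=
  ⟨(f ⌊s⌋, f (⌊s⌋ + 1), Int.fract s), h.1 _, Int.fract_nonneg s, (Int.fract_lt_one s).le⟩

lemma Cyc.dist_le_nat (hG : G.Connected) {L : ℕ} {f : ℤ → V} (h : Cyc G L f) (i : ℤ) (k : ℕ) :
    G.dist (f i) (f (i + k)) ≤ k := by
  induction k with
  | zero => simp
  | succ k ih =>
    have h1 := hG.dist_triangle (u := f i) (v := f (i + k)) (w := f (i + (k + 1 : ℕ)))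
    have h2 : G.dist (f (i + k)) (f (i + (k + 1 : ℕ))) = 1 := by
      rw [SimpleGraph.dist_eq_one_iff_adj]
      have := h.1 (i + k)
      rwa [show i + (k : ℤ) + 1 = i + (k + 1 : ℕ) by push_cast; ring] at this
    omega

lemma Cyc.lip_aux (hG : G.Connected) {L : ℕ} {f : ℤ → V} (h : Cyc G L f) {s t : ℝ} (hst : s ≤ t) :
    mgDist G (h.curve s) (h.curve t) ≤ t - s := by
  have es := Int.floor_add_fract s
  have et := Int.floor_add_fract t
  rcases (Int.floor_le_floor hst).eq_or_lt with he | hlt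
  · have := mgDist_le1 (h.curve s) (h.curve t) (by simp [Cyc.curve, he]) (by simp [Cyc.curve, he])
    simp only [Cyc.curve] at this
    have e2 : (⌊s⌋ : ℝ) = ⌊t⌋ := by exact_mod_cast he
    rw [abs_sub_comm, abs_of_nonneg (by linarith)] at this
    refine this.trans (by linarith)
  · have h5 := mgDist_le5 (h.curve s) (h.curve t)
    simp only [Cyc.curve] at h5
    obtain ⟨k, hk⟩ := Int.eq_ofNat_of_zero_le (show 0 ≤ ⌊t⌋ - (⌊s⌋ + 1) by omega)
    have h6 := h.dist_le_nat hG (⌊s⌋ + 1) k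
    rw [show ⌊s⌋ + 1 + (k : ℤ) = ⌊t⌋ by omega] at h6
    have h7 : (G.dist (f (⌊s⌋ + 1)) (f ⌊t⌋) : ℝ) ≤ k := by exact_mod_cast h6
    have h8 : (⌊t⌋ : ℝ) - (⌊s⌋ + 1) = k := by exact_mod_cast hk
    refine h5.trans (by linarith)

lemma Cyc.lip (hG : G.Connected) {L : ℕ} {f : ℤ → V} (h : Cyc G L f) (s t : ℝ) :
    mgDist G (h.curve s) (h.curve t) ≤ |s - t| := by
  rcases le_total s t with hst | hst
  · rw [abs_sub_comm, abs_of_nonneg (by linarith)]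
    exact h.lip_aux hG hst
  · rw [abs_of_nonneg (by linarith), mgDist_comm hG]
    exact h.lip_aux hG hst

lemma Cyc.geod (hG : G.Connected) {L : ℕ} {f : ℤ → V} (h : Cyc G L f) {a b : ℝ} (hab : a ≤ b)
    (hd : b - a ≤ mgDist G (h.curve a) (h.curve b)) : IsMGGeodesic G a b h.curve := by
  have key : ∀ s ∈ Set.Icc a b, ∀ t ∈ Set.Icc a b, s ≤ t →
      mgDist G (h.curve s) (h.curve t) = t - s := by
    intro s hs t ht hst
    apply le_antisymm (h.lip_aux hG hst)
    have h1 := mgDist_triangle hG (h.curve a) (h.curve s) (h.curve b)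
    have h2 := mgDist_triangle hG (h.curve s) (h.curve t) (h.curve b)
    have h3 := h.lip_aux hG hs.1
    have h4 := h.lip_aux hG ht.2
    linarith
  refine ⟨hab, fun s hs t ht => ?_⟩
  rcases le_total s t with hst | hst
  · rw [abs_sub_comm, abs_of_nonneg (by linarith)]
    exact key s hs t ht hst
  · rw [abs_of_nonneg (by linarith), mgDist_comm hG]
    exact key t ht s hs hst

lemma Cyc.closed (hG : G.Connected) {L : ℕ} {f : ℤ → V} (h : Cyc G L f) (s : ℝ) :
    mgDist G (h.curve (s + L)) (h.curve s) = 0 := by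
  have e : h.curve (s + L) = h.curve s := by
    unfold Cyc.curve
    have h1 : ⌊s + (L : ℝ)⌋ = ⌊s⌋ + L := by simp
    have h2 : Int.fract (s + (L : ℝ)) = Int.fract s := by simp
    have h3 : f (⌊s⌋ + L) = f ⌊s⌋ := (h.2 _ _).2 (by simp)
    have h4 : f (⌊s⌋ + L + 1) = f (⌊s⌋ + 1) := (h.2 _ _).2 ⟨1, by ring⟩
    apply Subtype.ext
    simp only [h1, h2, h3, h4]
  rw [e, mgDist_self hG]

/-- The cycle is isometric. -/
def CycIso (G : SimpleGraph V) (L : ℕ) (f : ℤ → V) : Prop :=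
  ∀ i j, ∃ k : ℤ, |i - j + k * L| ≤ (G.dist (f i) (f j) : ℤ)

lemma Cyc.le_dist (hG : G.Connected) {L : ℕ} (hL : 3 ≤ L) {f : ℤ → V} (h : Cyc G L f)
    (hi : CycIso G L f) (s t M : ℝ) (hM : ∀ k : ℤ, M ≤ |s - t + k * L|) :
    M ≤ mgDist G (h.curve s) (h.curve t) := by
  have es := Int.floor_add_fract s
  have et := Int.floor_add_fract t
  have s0 := Int.fract_nonneg s
  have t0 := Int.fract_nonneg t
  have s1 := (Int.fract_lt_one s).le
  have t1 := (Int.fract_lt_one t).le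
  have main : ∀ i j : ℤ, ∀ x y : ℝ, |s - i| ≤ x → |t - j| ≤ y →
      M ≤ x + (G.dist (f i) (f j) : ℝ) + y := by
    intro i j x y hx hy
    obtain ⟨k, hk⟩ := hi i j
    have hk' : |(i : ℝ) - j + k * L| ≤ G.dist (f i) (f j) := by exact_mod_cast hk
    have := hM k
    rw [abs_le] at hx hy hk'
    refine this.trans ?_
    rw [abs_le]
    constructor <;> linarith
  apply le_mgDist hG <;> simp only [Cyc.curve]
  · intro e1 _
    obtain ⟨k, hk⟩ := (h.2 _ _).1 e1
    have hk' : (⌊s⌋ : ℝ) - ⌊t⌋ = L * k := by exact_mod_cast hk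
    refine (hM (-k)).trans (le_of_eq ?_)
    congr 1
    push_cast
    linarith
  · intro e1 e2
    have d1 := (h.2 _ _).1 e1
    have d2 := (h.2 _ _).1 e2
    have := Int.le_of_dvd (by norm_num) (show (L : ℤ) ∣ 2 by
      have := dvd_sub d2 d1
      ring_nf at this
      exact this)
    omega
  · apply main <;> rw [abs_le] <;> constructor <;> linarith
  · apply main <;> rw [abs_le] <;> constructor <;> push_cast <;> linarith
  · apply main <;> rw [abs_le] <;> constructor <;> push_cast <;> linarith
  · apply main <;> rw [abs_le] <;> constructor <;> push_cast <;> linarith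

lemma Cyc.hyp_iso (hG : G.Connected) {L : ℕ} (hL : 3 ≤ L) {f : ℤ → V} (h : Cyc G L f)
    (hi : CycIso G L f) : (L : ℝ) / 4 ≤ hypDelta G := by
  have hL0 : (0 : ℝ) < L := by positivity
  have kk : ∀ k : ℤ, k ≤ 0 ∨ 1 ≤ k := fun k => by omega
  have kR : ∀ k : ℤ, (k : ℝ) * L ≤ 0 ∨ (L : ℝ) ≤ (k : ℝ) * L := by
    intro k
    rcases kk k with h | h
    · left
      have : (k : ℝ) ≤ 0 := by exact_mod_cast h
      nlinarith
    · right
      have : (1 : ℝ) ≤ k := by exact_mod_cast h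
      nlinarith
  refine le_hyp_of_bigon hG (γ := h.curve) (a := 0) (b := L / 2) (c := 0 + L) (s := L / 4)
    (h.geod hG (by linarith) ?_) (h.geod hG (by linarith) ?_) (h.closed hG 0)
    ⟨by linarith, by linarith⟩ ?_
  · apply h.le_dist hG hL hi
    intro k
    rw [le_abs]
    rcases kR k with h | h
    · right; linarith
    · left; linarith
  · apply h.le_dist hG hL hi
    intro k
    rw [le_abs]
    rcases kR k with h | h
    · right; linarith
    · left; linarith
  · intro t ht
    have := ht.1
    have := ht.2
    apply h.le_dist hG hL hi
    intro k
    rw [le_abs]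
    rcases kR k with h | h
    · right; linarith
    · left; linarith

lemma Cyc.one_le_dist (hG : G.Connected) {L : ℕ} {f : ℤ → V} (h : Cyc G L f) {i j : ℤ}
    (hij : ¬ (L : ℤ) ∣ i - j) : (1 : ℝ) ≤ G.dist (f i) (f j) := by
  have := hG.pos_dist_of_ne (fun e => hij ((h.2 i j).1 e))
  exact_mod_cast this

lemma Cyc.iso_three (hG : G.Connected) {f : ℤ → V} (h : Cyc G 3 f) : CycIso G 3 f := by
  intro i j
  by_cases hd : (3 : ℤ) ∣ i - j
  · obtain ⟨k, hk⟩ := hd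
    exact ⟨-k, by rw [hk]; push_cast; ring_nf; simp⟩
  · have h1 : 1 ≤ G.dist (f i) (f j) := by
      have := h.one_le_dist hG (i := i) (j := j) (by exact_mod_cast hd)
      exact_mod_cast this
    have : i - j + (-((i - j + 1) / 3)) * 3 ≤ 1 ∧ -1 ≤ i - j + (-((i - j + 1) / 3)) * 3 := by omega
    refine ⟨-((i - j + 1) / 3), ?_⟩
    push_cast
    rw [abs_le]
    omega

lemma Cyc.hyp_four (hG : G.Connected) {f : ℤ → V} (h : Cyc G 4 f) : (1 : ℝ) ≤ hypDelta G := by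
  have c1 : h.curve (1 / 2) = ⟨(f 0, f 1, 1 / 2), h.1 0, by norm_num, by norm_num⟩ := by
    have : ⌊(1 / 2 : ℝ)⌋ = 0 := by rw [Int.floor_eq_iff]; norm_num
    apply Subtype.ext; simp only [Cyc.curve, Int.fract, this]; norm_num
  have c2 : h.curve (3 / 2) = ⟨(f 1, f 2, 1 / 2), h.1 1, by norm_num, by norm_num⟩ := by
    have : ⌊(3 / 2 : ℝ)⌋ = 1 := by rw [Int.floor_eq_iff]; norm_num
    apply Subtype.ext; simp only [Cyc.curve, Int.fract, this]; norm_num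
  have c3 : h.curve (5 / 2) = ⟨(f 2, f 3, 1 / 2), h.1 2, by norm_num, by norm_num⟩ := by
    have : ⌊(5 / 2 : ℝ)⌋ = 2 := by rw [Int.floor_eq_iff]; norm_num
    apply Subtype.ext; simp only [Cyc.curve, Int.fract, this]; norm_num
  have c4 : h.curve (1 / 2 + (4 : ℕ)) = ⟨(f 4, f 5, 1 / 2), h.1 4, by norm_num, by norm_num⟩ := by
    have : ⌊(1 / 2 + (4 : ℕ) : ℝ)⌋ = 4 := by rw [Int.floor_eq_iff]; norm_num
    apply Subtype.ext; simp only [Cyc.curve, Int.fract, this]; norm_num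
  have ne : ∀ i j : ℤ, ¬ (4 : ℤ) ∣ i - j → f i ≠ f j := fun i j hij e =>
    hij (by exact_mod_cast (h.2 i j).1 e)
  have od : ∀ i j : ℤ, ¬ (4 : ℤ) ∣ i - j → (1 : ℝ) ≤ G.dist (f i) (f j) := fun i j hij =>
    h.one_le_dist hG (by exact_mod_cast hij)
  refine le_hyp_of_bigon hG (γ := h.curve) (a := 1 / 2) (b := 5 / 2) (c := 1 / 2 + (4 : ℕ))
    (s := 3 / 2)
    (h.geod hG (by norm_num) ?_) (h.geod hG (by norm_num) ?_) (h.closed hG _)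
    ⟨by norm_num, by norm_num⟩ ?_
  · rw [c1, c3]
    apply le_mgDist hG <;> dsimp only
    · intro e; exact absurd e (ne 0 2 (by norm_num))
    · intro e; exact absurd e (ne 0 3 (by norm_num))
    · linarith [od 0 2 (by norm_num)]
    · linarith [od 0 3 (by norm_num)]
    · linarith [od 1 2 (by norm_num)]
    · linarith [od 1 3 (by norm_num)]
  · rw [c4, c3]
    apply le_mgDist hG <;> dsimp only
    · intro e; exact absurd e (ne 2 4 (by norm_num))
    · intro e; exact absurd e (ne 2 5 (by norm_num))
    · push_cast; linarith [od 2 4 (by norm_num)]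
    · push_cast; linarith [od 2 5 (by norm_num)]
    · push_cast; linarith [od 3 4 (by norm_num)]
    · push_cast; linarith [od 3 5 (by norm_num)]
  · intro t ht
    have ht1 := ht.1
    have ht2 := ht.2
    push_cast at ht2
    have et := Int.floor_add_fract t
    have t0 := Int.fract_nonneg t
    have t1 := (Int.fract_lt_one t).le
    have nn : ∀ u v, (0:ℝ) ≤ G.dist u v := fun u v => by positivity
    rw [c2]
    have f1 : 2 ≤ ⌊t⌋ := by rw [Int.le_floor]; push_cast; linarith
    have f2 : ⌊t⌋ ≤ 4 := by
      have : ⌊t⌋ < 5 := by rw [Int.floor_lt]; push_cast; linarith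
      omega
    have z2 : (2 : ℤ) + 1 = 3 := rfl
    have z3 : (3 : ℤ) + 1 = 4 := rfl
    have z4 : (4 : ℤ) + 1 = 5 := rfl
    have f3 : ⌊t⌋ = 2 ∨ ⌊t⌋ = 3 ∨ ⌊t⌋ = 4 := by omega
    rcases f3 with f3 | f3 | f3
    · have e : (⌊t⌋ : ℝ) = 2 := by exact_mod_cast f3
      apply le_mgDist hG <;> simp only [Cyc.curve, f3, z2, z3, z4]
      · intro e; exact absurd e (ne 1 2 (by norm_num))
      · intro e; exact absurd e (ne 1 _ (by norm_num))
      · linarith [od 1 2 (by norm_num)]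
      · linarith [od 1 3 (by norm_num)]
      · linarith [nn (f 2) (f 2)]
      · linarith [od 2 3 (by norm_num)]
    · apply le_mgDist hG <;> simp only [Cyc.curve, f3, z2, z3, z4]
      · intro e; exact absurd e (ne 1 3 (by norm_num))
      · intro e; exact absurd e (ne 1 _ (by norm_num))
      · linarith [od 1 3 (by norm_num)]
      · linarith [od 1 4 (by norm_num)]
      · linarith [od 2 3 (by norm_num)]
      · linarith [od 2 4 (by norm_num)]
    · have e : (⌊t⌋ : ℝ) = 4 := by exact_mod_cast f3
      apply le_mgDist hG <;> simp only [Cyc.curve, f3, z2, z3, z4]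
      · intro e; exact absurd e (ne 1 4 (by norm_num))
      · intro _ e; exact absurd e (ne 2 _ (by norm_num))
      · linarith [od 1 4 (by norm_num)]
      · linarith [nn (f 1) (f 5)]
      · linarith [od 2 4 (by norm_num)]
      · linarith [od 2 5 (by norm_num)]

end Cycles

section Minimal

variable {V : Type} [Fintype V] [DecidableEq V] {G : SimpleGraph V}

lemma Cyc.iso_core (hG : G.Connected) {L : ℕ} (hL : 5 ≤ L) {f : ℤ → V} (h : Cyc G L f)
    (hmin : ∀ N, 4 ≤ N → N < L → ¬ ∃ f, Cyc G N f) (m : ℕ)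
    (IH : ∀ a b, G.dist (f a) (f b) < m → ∃ k : ℤ, |a - b + k * L| ≤ (G.dist (f a) (f b) : ℤ))
    (i : ℤ) (d : ℕ) (hd : 2 * d ≤ L) (hm : G.dist (f i) (f (i + d)) = m) :
    ∃ k : ℤ, |i - (i + d) + k * L| ≤ (m : ℤ) := by
  by_cases hdm : d ≤ m
  · refine ⟨0, ?_⟩
    rw [abs_le]; constructor <;> push_cast <;> linarith
  push Not at hdm
  have inj : ∀ a b : ℤ, a < b → b < a + L → f a ≠ f b := by
    intro a b hab hb e
    have := (h.2 b a).1 e.symm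
    have := Int.le_of_dvd (by omega) this
    omega
  have m0 : m ≠ 0 := by
    rintro rfl
    rw [hG.dist_eq_zero_iff] at hm
    exact inj _ _ (by omega) (by omega) hm
  by_cases hsp : m = 1 ∧ d = 2
  · exfalso
    obtain ⟨rfl, rfl⟩ := hsp
    rw [SimpleGraph.dist_eq_one_iff_adj] at hm
    refine hmin (L - 1) (by omega) (by omega) (mkCyc (by omega) (fun t => f (i + 2 + t)) ?_ ?_ ?_)
    · intro a b hab hb
      exact inj _ _ (by omega) (by omega)
    · intro a ha
      have := h.1 (i + 2 + a)
      rwa [add_assoc (i + 2)] at this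
    · have e : f (i + 2 + ((L - 1 - 1 : ℕ) : ℤ)) = f i := (h.2 _ _).2 ⟨1, by omega⟩
      simp only [e]
      simpa using hm
  obtain ⟨p, hp, hpl⟩ := hG.exists_path_of_dist (f (i + d)) (f i)
  rw [SimpleGraph.dist_comm, hm] at hpl
  by_cases hinner : ∃ a l, 0 < a ∧ a < m ∧ p.getVert a = f l
  · obtain ⟨a, l, ha0, ham, hal⟩ := hinner
    have d1 : G.dist (f (i + d)) (f l) ≤ a := by
      have := SimpleGraph.dist_le (p.take a)
      rw [SimpleGraph.Walk.take_length, hal] at this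
      omega
    have d2 : G.dist (f l) (f i) ≤ m - a := by
      have := SimpleGraph.dist_le (p.drop a)
      rw [SimpleGraph.Walk.drop_length, hal] at this
      omega
    obtain ⟨k1, hk1⟩ := IH (i + d) l (by omega)
    obtain ⟨k2, hk2⟩ := IH l i (by omega)
    refine ⟨-(k1 + k2), ?_⟩
    have e : -(k1 + k2) * (L : ℤ) = -(k1 * L) - k2 * L := by ring
    rw [e]
    rw [abs_le] at hk1 hk2 ⊢
    omega
  · exfalso
    push Not at hinner
    have hge : ∀ t : ℕ, d ≤ t → (if t ≤ d then f (i + t) else p.getVert (t - d)) =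
        p.getVert (t - d) := by
      intro t ht
      split_ifs with h1
      · have : t = d := by omega
        subst this
        simp
      · rfl
    refine hmin (d + m) (by omega) (by omega)
      (mkCyc (by omega) (fun t => if t ≤ d then f (i + t) else p.getVert (t - d)) ?_ ?_ ?_)
    · intro a b hab hb
      by_cases h1 : b ≤ d
      · simp only [h1, show a ≤ d by omega, if_true]
        exact inj _ _ (by omega) (by omega)
      · by_cases h2 : a ≤ d
        · simp only [h1, h2, if_true, if_false]
          exact fun e => hinner (b - d) _ (by omega) (by omega) e.symm
        · simp only [h1, h2, if_false]
          intro e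
          have := hp.getVert_injOn (show a - d ≤ p.length by omega)
            (show b - d ≤ p.length by omega) e
          omega
    · intro a ha
      by_cases h1 : a + 1 ≤ d
      · simp only [h1, show a ≤ d by omega, if_true]
        have := h.1 (i + a)
        rwa [add_assoc] at this
      · simp only [hge a (by omega), hge (a + 1) (by omega)]
        have := p.adj_getVert_succ (i := a - d) (by omega)
        rwa [show a - d + 1 = a + 1 - d by omega] at this
    · simp only [hge (d + m - 1) (by omega)]
      have := p.adj_getVert_succ (i := m - 1) (by omega)
      rw [show m - 1 + 1 = p.length by omega, p.getVert_length] at this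
      simpa [show d + m - 1 - d = m - 1 by omega] using this

lemma Cyc.iso_min (hG : G.Connected) {L : ℕ} (hL : 5 ≤ L) {f : ℤ → V} (h : Cyc G L f)
    (hmin : ∀ N, 4 ≤ N → N < L → ¬ ∃ f, Cyc G N f) : CycIso G L f := by
  have key : ∀ m i j, G.dist (f i) (f j) = m →
      ∃ k : ℤ, |i - j + k * L| ≤ (G.dist (f i) (f j) : ℤ) := by
    intro m
    induction m using Nat.strong_induction_on with
    | _ m ih =>
      intro i j hm
      have IH : ∀ a b, G.dist (f a) (f b) < m →
          ∃ k : ℤ, |a - b + k * L| ≤ (G.dist (f a) (f b) : ℤ) :=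
        fun a b hab => ih _ hab a b rfl
      have hL0 : (0 : ℤ) < L := by omega
      have r0 := Int.emod_nonneg (j - i) hL0.ne'
      have r1 := Int.emod_lt_of_pos (j - i) hL0
      have rq := Int.emod_add_mul_ediv (j - i) L
      generalize (j - i) % L = r at *
      generalize (j - i) / L = q at *
      rw [mul_comm] at rq
      by_cases hr : 2 * r ≤ L
      · obtain ⟨d, rfl⟩ := Int.eq_ofNat_of_zero_le r0
        have e : f (i + d) = f j := (h.2 _ _).2 ⟨-q, by linarith⟩
        obtain ⟨k, hk⟩ := h.iso_core hG hL hmin m IH i d (by omega) (by rw [e, hm])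
        refine ⟨k + q, ?_⟩
        rw [hm]
        refine le_of_eq_of_le ?_ hk
        congr 1
        linarith
      · obtain ⟨d, hd⟩ := Int.eq_ofNat_of_zero_le (show 0 ≤ L - r by omega)
        have e : f (j + d) = f i := (h.2 _ _).2 ⟨q + 1, by linarith⟩
        obtain ⟨k, hk⟩ := h.iso_core hG hL hmin m IH j d (by omega)
          (by rw [e, SimpleGraph.dist_comm, hm])
        refine ⟨-k + q + 1, ?_⟩
        rw [hm]
        refine le_of_eq_of_le ?_ hk
        rw [← abs_neg]
        congr 1
        linarith
  intro i j
  exact key _ i j rfl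

lemma one_le_hyp (hG : G.Connected) (h : ∃ L, 4 ≤ L ∧ ∃ f, Cyc G L f) : 1 ≤ hypDelta G := by
  classical
  obtain ⟨h4, f, hf⟩ := Nat.find_spec h
  have hmin : ∀ N, 4 ≤ N → N < Nat.find h → ¬ ∃ f, Cyc G N f :=
    fun N hN hlt hc => Nat.find_min h hlt ⟨hN, hc⟩
  generalize Nat.find h = L at *
  rcases h4.eq_or_lt with rfl | h5
  · exact hf.hyp_four hG
  · have := hf.hyp_iso hG (by omega) (hf.iso_min hG h5 hmin)
    have : (5 : ℝ) ≤ L := by exact_mod_cast h5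
    linarith

end Minimal

section Extremal

/-- A clique on the first `c` vertices, all the other vertices being pendant at `0`. -/
def KG (c n : ℕ) : SimpleGraph (Fin n) where
  Adj u v := u ≠ v ∧ ((u.val < c ∧ v.val < c) ∨ u.val = 0 ∨ v.val = 0)
  symm := ⟨by
    rintro u v ⟨h, h'⟩
    exact ⟨h.symm, by tauto⟩⟩
  loopless := ⟨by
    rintro u ⟨h, -⟩
    exact h rfl⟩

variable {c n : ℕ}

lemma KG_adj (u v : Fin n) : (KG c n).Adj u v ↔
    u ≠ v ∧ ((u.val < c ∧ v.val < c) ∨ u.val = 0 ∨ v.val = 0) := Iff.rfl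

lemma KG_dist_le (u v : Fin n) (h : (u.val < c ∧ v.val < c) ∨ u.val = 0 ∨ v.val = 0) :
    (KG c n).dist u v ≤ 1 := by
  by_cases huv : u = v
  · subst huv; simp
  · exact (SimpleGraph.dist_eq_one_iff_adj.mpr ((KG_adj u v).2 ⟨huv, h⟩)).le

lemma KG_conn (h3 : 3 ≤ c) (hcn : c ≤ n) : (KG c n).Connected := by
  have : Nonempty (Fin n) := ⟨⟨0, by omega⟩⟩
  refine ⟨?_⟩
  have h0 : ∀ u : Fin n, (KG c n).Reachable u ⟨0, by omega⟩ := by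
    intro u
    by_cases hu : u = ⟨0, by omega⟩
    · rw [hu]
    · exact SimpleGraph.Adj.reachable ((KG_adj _ _).2 ⟨hu, by simp⟩)
  intro u v
  exact (h0 u).trans (h0 v).symm

/-- The block of a vertex. -/
def KGl (c : ℕ) (u : Fin n) : ℕ := if c ≤ u.val then u.val else 0

/-- The block of a point. -/
def KGlab (c n : ℕ) (p : MGPoint (KG c n)) : ℕ :=
  if c ≤ p.1.1.val then p.1.1.val else KGl c p.1.2.1

lemma KG_key (h3 : 3 ≤ c) (hcn : c ≤ n) (z : Fin n) (hz : z.val = 0) (u v : Fin n)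
    (h : u.val ≠ 0 → v.val ≠ 0 → KGl c u ≠ KGl c v) :
    ((KG c n).dist u z : ℝ) + (KG c n).dist v z ≤ (KG c n).dist u v := by
  have hc := KG_conn h3 hcn
  by_cases hu : u.val = 0
  · have : u = z := Fin.ext (by omega)
    subst this
    rw [SimpleGraph.dist_self, SimpleGraph.dist_comm]; simp
  by_cases hv : v.val = 0
  · have : v = z := Fin.ext (by omega)
    subst this
    rw [SimpleGraph.dist_self]; simp
  have hh := h hu hv
  have h1 := KG_dist_le (c := c) u z (by omega)
  have h2 := KG_dist_le (c := c) v z (by omega)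
  have hne : u ≠ v := by rintro rfl; exact hh rfl
  have hna : ¬ (KG c n).Adj u v := by
    rintro ⟨-, ⟨ha, hb⟩ | ha | ha⟩
    · apply hh; unfold KGl; rw [if_neg (by omega), if_neg (by omega)]
    · exact hu ha
    · exact hv ha
  have h4 := hc.one_lt_dist_of_ne_of_not_adj hne hna
  have : (KG c n).dist u z + (KG c n).dist v z ≤ (KG c n).dist u v := by omega
  exact_mod_cast this

lemma KG_lab1 (h3 : 3 ≤ c) (p : MGPoint (KG c n)) (h : p.1.1.val ≠ 0) :
    KGlab c n p = KGl c p.1.1 := by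
  obtain ⟨⟨u, v, t⟩, ⟨hn, hp⟩, ht⟩ := p
  simp only at hn hp h ⊢
  unfold KGlab KGl
  simp only
  split_ifs <;> omega

lemma KG_lab2 (h3 : 3 ≤ c) (p : MGPoint (KG c n)) (h : p.1.2.1.val ≠ 0) :
    KGlab c n p = KGl c p.1.2.1 := by
  obtain ⟨⟨u, v, t⟩, ⟨hn, hp⟩, ht⟩ := p
  simp only at hn hp h ⊢
  unfold KGlab KGl
  simp only
  split_ifs <;> omega

lemma KG_cut (h3 : 3 ≤ c) (hcn : c ≤ n) (D : ℝ) (hD : 3 / 2 ≤ D) (hD' : 3 < c → 2 ≤ D) :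
    ∃ O, CutData (KG c n) O (KGlab c n) D := by
  have hc := KG_conn h3 hcn
  let z : Fin n := ⟨0, by omega⟩
  have hz : z.val = 0 := rfl
  let O : MGPoint (KG c n) := ⟨(z, ⟨1, by omega⟩, 0),
    ⟨by simp [z], Or.inr (Or.inl rfl)⟩, by simp⟩
  have hO1 : ∀ p : MGPoint (KG c n),
      mgDist (KG c n) p O ≤ p.1.2.2 + ((KG c n).dist p.1.1 z : ℝ) := by
    intro p
    have := mgDist_le3 p O
    simpa [O] using this
  have hO2 : ∀ p : MGPoint (KG c n),
      mgDist (KG c n) p O ≤ (1 - p.1.2.2) + ((KG c n).dist p.1.2.1 z : ℝ) := by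
    intro p
    have := mgDist_le5 p O
    simpa [O] using this
  have hd1 : ∀ u v : Fin n, (u.val < c ∧ v.val < c) ∨ u.val = 0 ∨ v.val = 0 →
      ((KG c n).dist u v : ℝ) ≤ 1 := by
    intro u v h
    exact_mod_cast KG_dist_le u v h
  refine ⟨O, ?_, hD, ?_, ?_⟩
  · intro p
    have h1 := hO1 p
    have h2 := hO2 p
    have h3 := hd1 p.1.1 z (by omega)
    have h4 := hd1 p.1.2.1 z (by omega)
    linarith
  · intro p q hpq
    by_cases h0 : KGlab c n p = 0
    · -- both in the clique
      have b : ∀ r : MGPoint (KG c n), KGlab c n r = 0 → r.1.1.val < c ∧ r.1.2.1.val < c := by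
        intro r hr
        unfold KGlab KGl at hr
        split_ifs at hr <;> omega
      have bp := b p h0
      have bq := b q (by omega)
      have l3 := mgDist_le3 p q
      have l4 := mgDist_le4 p q
      have l5 := mgDist_le5 p q
      have l6 := mgDist_le6 p q
      have e3 := hd1 p.1.1 q.1.1 (by omega)
      have e4 := hd1 p.1.1 q.1.2.1 (by omega)
      have e5 := hd1 p.1.2.1 q.1.1 (by omega)
      have e6 := hd1 p.1.2.1 q.1.2.1 (by omega)
      by_cases hc3 : 3 < c
      · linarith [hD' hc3]
      · have hpa : p.1.1.val ≠ p.1.2.1.val := fun h => p.2.1.1 (Fin.ext h)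
        have hqa : q.1.1.val ≠ q.1.2.1.val := fun h => q.2.1.1 (Fin.ext h)
        have hsh : p.1.1.val = q.1.1.val ∨ p.1.1.val = q.1.2.1.val ∨ p.1.2.1.val = q.1.1.val
          ∨ p.1.2.1.val = q.1.2.1.val := by omega
        rcases hsh with h | h | h | h
        · rw [Fin.ext h, SimpleGraph.dist_self, Nat.cast_zero] at l3
          linarith
        · rw [Fin.ext h, SimpleGraph.dist_self, Nat.cast_zero] at l4
          linarith
        · rw [Fin.ext h, SimpleGraph.dist_self, Nat.cast_zero] at l5
          linarith
        · rw [Fin.ext h, SimpleGraph.dist_self, Nat.cast_zero] at l6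
          linarith
    · -- both in the same pendant edge
      have b : ∀ r : MGPoint (KG c n), KGlab c n r ≠ 0 →
          (r.1.1.val = 0 ∧ r.1.2.1.val = KGlab c n r) ∨
          (r.1.2.1.val = 0 ∧ r.1.1.val = KGlab c n r) := by
        intro r hr
        have := r.2.1.2
        unfold KGlab KGl at hr ⊢
        split_ifs at hr ⊢ <;> omega
      have bp := b p h0
      have bq := b q (by omega)
      have hp0 := p.2.2.1
      have hp1 := p.2.2.2
      have hq0 := q.2.2.1
      have hq1 := q.2.2.2
      have : (p.1.1.val = q.1.1.val ∧ p.1.2.1.val = q.1.2.1.val) ∨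
          (p.1.1.val = q.1.2.1.val ∧ p.1.2.1.val = q.1.1.val) := by omega
      rcases this with ⟨h, h'⟩ | ⟨h, h'⟩
      · refine (mgDist_le1 p q (Fin.ext h) (Fin.ext h')).trans ?_
        rw [abs_le]; constructor <;> linarith
      · refine (mgDist_le2 p q (Fin.ext h) (Fin.ext h')).trans ?_
        rw [abs_le]; constructor <;> linarith
  · intro p q hpq
    have k3 := KG_key h3 hcn z hz p.1.1 q.1.1
      (fun h h' => by rwa [← KG_lab1 h3 p h, ← KG_lab1 h3 q h'])
    have k4 := KG_key h3 hcn z hz p.1.1 q.1.2.1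
      (fun h h' => by rwa [← KG_lab1 h3 p h, ← KG_lab2 h3 q h'])
    have k5 := KG_key h3 hcn z hz p.1.2.1 q.1.1
      (fun h h' => by rwa [← KG_lab2 h3 p h, ← KG_lab1 h3 q h'])
    have k6 := KG_key h3 hcn z hz p.1.2.1 q.1.2.1
      (fun h h' => by rwa [← KG_lab2 h3 p h, ← KG_lab2 h3 q h'])
    have p1 := hO1 p
    have p2 := hO2 p
    have q1 := hO1 q
    have q2 := hO2 q
    apply le_mgDist hc
    · intro h h'
      exact absurd (by unfold KGlab; rw [h, h']) hpq
    · intro h h'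
      exfalso
      have hpa : p.1.1.val ≠ p.1.2.1.val := fun h => p.2.1.1 (Fin.ext h)
      by_cases h0 : p.1.1.val = 0
      · have : p.1.2.1.val ≠ 0 := by omega
        exact hpq (by rw [KG_lab2 h3 p this, KG_lab1 h3 q (by rwa [← h']), h'])
      · exact hpq (by rw [KG_lab1 h3 p h0, KG_lab2 h3 q (by rwa [← h]), h])
    · linarith
    · linarith
    · linarith
    · linarith

lemma KG_cycle_exists (h3 : 3 ≤ c) (hcn : c ≤ n) (m : ℕ) (hm : 3 ≤ m) (hmc : m ≤ c) :
    ∃ (a : Fin n) (w : (KG c n).Walk a a), w.IsCycle ∧ w.length = m := by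
  have : (SimpleGraph.cycleGraph m).IsContained (KG c n) := by
    refine ⟨⟨⟨fun i => ⟨i.val, by omega⟩, ?_⟩, ?_⟩⟩
    · intro a b hab
      refine ⟨?_, Or.inl ⟨by simp; omega, by simp; omega⟩⟩
      intro h
      exact hab.ne (Fin.ext (by simpa using h))
    · intro a b h
      have h' : (⟨a.val, by omega⟩ : Fin n) = ⟨b.val, by omega⟩ := h
      exact Fin.ext (by simpa using h')
  exact (SimpleGraph.cycleGraph_isContained_iff (by omega)).1 this

lemma KG_cycle_le (h3 : 3 ≤ c) {a : Fin n} (w : (KG c n).Walk a a) (hw : w.IsCycle) :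
    w.length ≤ c := by
  have hl := hw.three_le_length
  obtain ⟨f, hf1, hf2⟩ := Cyc.of_walk hw
  have hlt : ∀ i, (f i).val < c := by
    intro i
    by_contra hge
    have a1 := hf1 i
    have a2 := hf1 (i - 1)
    rw [sub_add_cancel] at a2
    have b1 := a1.2
    have b2 := a2.2
    have : f (i + 1) = f (i - 1) := Fin.ext (by omega)
    rw [hf2] at this
    have := Int.le_of_dvd (by omega) this
    omega
  let g : Fin w.length → Fin c := fun i => ⟨(f (i.val : ℤ)).val, hlt _⟩
  have hg : Function.Injective g := by
    intro i j hij
    have h1 : f (i.val : ℤ) = f (j.val : ℤ) := by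
      apply Fin.ext
      simpa [g] using hij
    rw [hf2] at h1
    have h2 : (i.val : ℤ) - j.val = 0 := by
      apply Int.eq_zero_of_abs_lt_dvd h1
      rw [abs_lt]
      constructor <;> omega
    exact Fin.ext (by omega)
  simpa using Fintype.card_le_of_injective g hg

lemma KG_mem (h3 : 3 ≤ c) (hcn : c ≤ n) : memGclass 3 c (KG c n) := by
  refine ⟨KG_conn h3 hcn, ?_, ?_⟩
  · obtain ⟨a, w, hw, hl⟩ := KG_cycle_exists h3 hcn 3 le_rfl h3
    apply le_antisymm
    · rw [← hl]; exact SimpleGraph.girth_le_length hw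
    · exact SimpleGraph.three_le_girth (fun h => h w hw)
  · apply IsGreatest.csSup_eq
    constructor
    · exact KG_cycle_exists h3 hcn c h3 le_rfl
    · rintro m ⟨a, w, hw, rfl⟩
      exact KG_cycle_le h3 w hw

lemma lower_three {G : SimpleGraph (Fin n)} (h : memGclass 3 c G) : 3 / 4 ≤ hypDelta G := by
  obtain ⟨hG, hg, -⟩ := h
  have hna : ¬ G.IsAcyclic := by
    intro hh
    rw [SimpleGraph.girth_eq_zero.mpr hh] at hg
    omega
  obtain ⟨a, w, hw, hl⟩ := SimpleGraph.exists_girth_eq_length.mpr hna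
  obtain ⟨f, hf⟩ := Cyc.of_walk hw
  rw [← hl, hg] at hf
  have := Cyc.hyp_iso hG le_rfl hf (Cyc.iso_three hG hf)
  simpa using this

lemma lower_four {G : SimpleGraph (Fin n)} (hc : 3 < c) (h : memGclass 3 c G) :
    1 ≤ hypDelta G := by
  obtain ⟨hG, -, hcirc⟩ := h
  apply one_le_hyp hG
  by_contra hcon
  have : circumference G ≤ 3 := by
    apply csSup_le'
    rintro m ⟨a, w, hw, rfl⟩
    by_contra hlt
    exact hcon ⟨w.length, by omega, Cyc.of_walk hw⟩
  omega

end Extremal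

/-- Theorem (calculo1): For any integers `3 ≤ c ≤ n`, `A(3,c,n) = 3/4` if `c = 3`,
and `A(3,c,n) = 1` if `c > 3`. -/
theorem Agcn_three (c n : ℕ) (h3 : 3 ≤ c) (hcn : c ≤ n) :
    (c = 3 → Agcn 3 c n = 3 / 4) ∧ (3 < c → Agcn 3 c n = 1) := by
  constructor
  · intro hc
    apply IsLeast.csInf_eq
    constructor
    · refine ⟨KG c n, KG_mem h3 hcn, ?_⟩
      obtain ⟨O, hO⟩ := KG_cut h3 hcn (3 / 2) le_rfl (by omega)
      have h1 := hO.hyp_le (KG_conn h3 hcn)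
      have h2 := lower_three (KG_mem h3 hcn)
      linarith
    · rintro d ⟨G, hG, rfl⟩
      exact lower_three hG
  · intro hc
    apply IsLeast.csInf_eq
    constructor
    · refine ⟨KG c n, KG_mem h3 hcn, ?_⟩
      obtain ⟨O, hO⟩ := KG_cut h3 hcn 2 (by norm_num) (fun _ => le_rfl)
      have h1 := hO.hyp_le (KG_conn h3 hcn)
      have h2 := lower_four hc (KG_mem h3 hcn)
      linarith
    · rintro d ⟨G, hG, rfl⟩
      exact lower_four hc hG
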